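/- Let N be a nonempty compact connected metric space and φ a continuous flow on N. Let Λ ⊆ N be a nonempty compact invariant set that is an attractor (with some isolating neighborhood) for φ and is also an attractor (with some isolating neighborhood) for the time-reversed flow φ̄_t := φ_{−t}. Then Λ = N. -/

import Mathlib

/-- A nonempty compact invariant set of a continuous flow on a
nonempty compact connected metric space that is an attractor both for the flow and
for the time-reversed flow must be the whole space. -/
theorem attractor_for_both_flows_eq_univ
    {N : Type*} [MetricSpace N] [CompactSpace N] [ConnectedSpace N] [Nonempty N]
    (φ : ℝ → N → N)
    (hcont : Continuous fun p : ℝ × N => φ p.1 p.2)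
    (hzero : ∀ z : N, φ 0 z = z)
    (hadd : ∀ t s : ℝ, ∀ z : N, φ (t + s) z = φ t (φ s z))
    (Λ : Set N)
    (hΛne : Λ.Nonempty)
    (hΛcompact : IsCompact Λ)
    (hΛinv : ∀ t : ℝ, φ t '' Λ = Λ)
    (hattr : ∃ U : Set N, IsOpen U ∧ Λ = (⋂ t : ℝ, φ t '' U) ∧
      ∃ t₀ : ℝ, 0 < t₀ ∧ ∀ t : ℝ, t₀ ≤ t → φ t '' closure U ⊆ U)
    (hattr' : ∃ U' : Set N, IsOpen U' ∧ Λ = (⋂ t : ℝ, φ (-t) '' U') ∧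
      ∃ t₀ : ℝ, 0 < t₀ ∧ ∀ t : ℝ, t₀ ≤ t → φ (-t) '' closure U' ⊆ U') :
    Λ = Set.univ := by
  obtain ⟨U, hUo, hU, t₀, ht₀, hUt⟩ := hattr
  obtain ⟨U', hUo', hU', t₁, ht₁, hUt'⟩ := hattr'
  have hφ (t : ℝ) : Continuous (φ t) := hcont.comp (by fun_prop : Continuous fun z => (t, z))
  have hΛU : Λ ⊆ U := by
    rw [hU]
    refine (Set.iInter_subset _ 0).trans ?_
    rintro _ ⟨z, hz, rfl⟩
    rwa [hzero]
  have hΛU' : Λ ⊆ U' := by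
    rw [hU']
    refine (Set.iInter_subset _ 0).trans ?_
    rintro _ ⟨z, hz, rfl⟩
    rwa [neg_zero, hzero]
  have hstep {s t : ℝ} (h : s + t₀ ≤ t) : φ t '' closure U ⊆ φ s '' U := by
    rintro _ ⟨z, hz, rfl⟩
    refine ⟨φ (t - s) z, hUt _ (by linarith) ⟨z, hz, rfl⟩, ?_⟩
    rw [← hadd, add_sub_cancel]
  have hstep' {s t : ℝ} (h : s + t₀ ≤ t) : φ t '' closure U ⊆ φ s '' closure U :=
    (hstep h).trans (Set.image_mono subset_closure)
  have hcompact (t : ℝ) : IsCompact (φ t '' closure U) :=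
    isClosed_closure.isCompact.image (hφ t)
  have hdir : Directed (· ⊇ ·) fun t : ℝ => φ t '' closure U := fun s t =>
    ⟨max s t + t₀, hstep' (by linarith [le_max_left s t]), hstep' (by linarith [le_max_right s t])⟩
  have hinter : ⋂ t : ℝ, φ t '' closure U ⊆ Λ := by
    rw [hU]
    exact Set.subset_iInter fun s => (Set.iInter_subset _ (s + t₀)).trans (hstep le_rfl)
  obtain ⟨T, hT⟩ := exists_subset_nhds_of_isCompact hdir hcompact
    fun x hx => hUo'.mem_nhds (hΛU' (hinter hx))
  have hUΛ : U ⊆ Λ := by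
    intro x hx
    rw [hU']
    refine Set.mem_iInter.2 fun s => ⟨φ s x, ?_, by rw [← hadd, neg_add_cancel, hzero]⟩
    set r := max (T + t₀) (s + t₁)
    have hr : φ r x ∈ U' :=
      hT (hstep' (le_max_left _ _) ⟨x, subset_closure hx, rfl⟩)
    refine hUt' (r - s) (by linarith [le_max_right (T + t₀) (s + t₁)])
      ⟨φ r x, subset_closure hr, ?_⟩
    rw [← hadd, neg_sub, sub_add_cancel]
  have hopen : IsOpen Λ := by rwa [hΛU.antisymm hUΛ]
  exact IsClopen.eq_univ ⟨hΛcompact.isClosed, hopen⟩ hΛne
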